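/- For every σ ≥ 1 with σk ∈ ℕ and δ = 2 + σ + 1/(3σ), there exist arbitrarily large graphs with average degree greater than δk − 2 that contain no (k+1)-connected subgraph on more than (1+σ)k vertices. -/

import Mathlib

/-- A graph is `m`-connected if it has more than `m` vertices and remains
connected after the removal of any set of fewer than `m` vertices. -/
def KConnected (m : ℕ) {V : Type} (G : SimpleGraph V) : Prop :=
  m < Nat.card V ∧ ∀ s : Set V, s.ncard < m → (G.induce sᶜ).Connected

/-- No `(k+1)`-connected graph on more than `s` vertices embeds into `G`. -/
def NoLargeConnected (k s : ℕ) {V : Type} (G : SimpleGraph V) : Prop :=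
  ∀ (W : Type) (H : SimpleGraph W) (f : H →g G), Function.Injective f →
    s < Nat.card W → ¬ KConnected (k + 1) H

/-- Two copies of `G` glued along the vertex set `X`. -/
def glue {V : Type} (G : SimpleGraph V) (X : Finset V) :
    SimpleGraph (V ⊕ {v // v ∉ X}) where
  Adj p q := G.Adj (p.elim id Subtype.val) (q.elim id Subtype.val) ∧
    (p.isLeft = q.isLeft ∨ p.elim id Subtype.val ∈ X ∨ q.elim id Subtype.val ∈ X)
  symm := ⟨fun p q h => ⟨h.1.symm, by
    rcases h.2 with h | h | h
    · exact Or.inl h.symm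
    · exact Or.inr (Or.inr h)
    · exact Or.inr (Or.inl h)⟩⟩
  loopless := ⟨fun p h => G.loopless.irrefl _ h.1⟩

/-- The projection of the glued graph onto the original one. -/
def glueProj {V : Type} (G : SimpleGraph V) (X : Finset V) : glue G X →g G where
  toFun p := p.elim id Subtype.val
  map_rel' h := h.1

open Classical in
/-- The embedding of the second copy of `G` into the glued graph. -/
noncomputable def glueRight {V : Type} (X : Finset V) (v : V) : V ⊕ {v // v ∉ X} :=
  if h : v ∈ X then Sum.inl v else Sum.inr ⟨v, h⟩

theorem glueRight_of_mem {V : Type} {X : Finset V} {v : V} (h : v ∈ X) :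
    glueRight X v = Sum.inl v := by
  simp [glueRight, h]

theorem glueRight_of_notMem {V : Type} {X : Finset V} {v : V} (h : v ∉ X) :
    glueRight X v = Sum.inr ⟨v, h⟩ := by
  simp [glueRight, h]

theorem glueRight_elim {V : Type} (X : Finset V) (v : V) :
    (glueRight X v).elim id Subtype.val = v := by
  by_cases h : v ∈ X
  · simp [glueRight_of_mem h]
  · simp [glueRight_of_notMem h]

theorem glueRight_injective {V : Type} (X : Finset V) : Function.Injective (glueRight X) :=
  Function.LeftInverse.injective (g := Sum.elim id Subtype.val) (glueRight_elim X)

theorem glueRight_eq_inl {V : Type} {X : Finset V} {v w : V} :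
    glueRight X v = Sum.inl w ↔ v = w ∧ v ∈ X := by
  by_cases h : v ∈ X
  · simp [glueRight_of_mem h, h]
  · simp [glueRight_of_notMem h, h]

theorem glue_adj_inl {V : Type} (G : SimpleGraph V) (X : Finset V) (v w : V) :
    (glue G X).Adj (Sum.inl v) (Sum.inl w) ↔ G.Adj v w := by
  simp [glue]

theorem glue_adj_glueRight {V : Type} (G : SimpleGraph V) (X : Finset V) (v w : V) :
    (glue G X).Adj (glueRight X v) (glueRight X w) ↔ G.Adj v w := by
  by_cases hv : v ∈ X <;> by_cases hw : w ∈ X <;>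
    simp [glue, glueRight, hv, hw]

theorem not_glue_adj_inl_glueRight {V : Type} (G : SimpleGraph V) {X : Finset V} {v w : V}
    (hv : v ∉ X) (hw : w ∉ X) : ¬ (glue G X).Adj (Sum.inl v) (glueRight X w) := by
  simp [glue, glueRight_of_notMem hw, hv, hw]

theorem exists_adj_of_connected {W : Type} {H : SimpleGraph W} (hH : H.Connected)
    {p : W → Prop} {a b : W} (ha : p a) (hb : ¬ p b) : ∃ x y, H.Adj x y ∧ p x ∧ ¬ p y := by
  obtain ⟨w⟩ := hH.preconnected a b
  obtain ⟨d, -, h1, h2⟩ := w.exists_boundary_dart {x | p x} ha hb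
  exact ⟨d.fst, d.snd, d.adj, h1, h2⟩

/-- Gluing along at most `k` vertices creates no new `(k+1)`-connected subgraphs. -/
theorem NoLargeConnected.glue {k s : ℕ} {V : Type} {G : SimpleGraph V} {X : Finset V}
    (hG : NoLargeConnected k s G) (hX : X.card ≤ k) : NoLargeConnected k s (glue G X) := by
  intro W H f hf hs hH
  have hinl : ∀ p : V ⊕ {v // v ∉ X}, p.elim id Subtype.val ∈ X → p.isLeft = true := by
    rintro (v | v) h
    · rfl
    · exact absurd h v.2
  have heq : ∀ p q : V ⊕ {v // v ∉ X}, p.isLeft = q.isLeft →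
      p.elim id Subtype.val = q.elim id Subtype.val → p = q := by
    rintro (v | v) (w | w) h h' <;> simp_all [Subtype.ext_iff]
  have key : ¬ Function.Injective ((glueProj G X).comp f) := fun h => hG W H _ h hs hH
  set t : Set W := {w | (f w).elim id Subtype.val ∈ X} with ht
  have htX : t.ncard < k + 1 := by
    have : t.ncard ≤ (X : Set V).ncard := by
      refine Set.ncard_le_ncard_of_injOn (fun w => (f w).elim id Subtype.val)
        (fun w hw => hw) ?_ (Set.toFinite _)
      intro a ha b hb hab
      exact hf (heq _ _ ((hinl _ ha).trans (hinl _ hb).symm) hab)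
    rw [Set.ncard_coe_finset] at this
    omega
  have hconn := hH.2 t htX
  simp only [Function.Injective, not_forall] at key
  obtain ⟨a, b, hab, hne⟩ := key
  replace hab : (f a).elim id Subtype.val = (f b).elim id Subtype.val := hab
  have hside : (f a).isLeft ≠ (f b).isLeft := fun h => hne (hf (heq _ _ h hab))
  have hat : a ∉ t := fun h => hside <| by
    rw [hinl _ h, hinl (f b) (by rw [← hab]; exact h)]
  have hbt : b ∉ t := fun h => hat (by rw [ht, Set.mem_ofPred_eq, hab]; exact h)
  obtain ⟨x, y, hxy, hx, hy⟩ := exists_adj_of_connected hconn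
    (p := fun x => (f x.1).isLeft = (f a).isLeft) (a := ⟨a, hat⟩) (b := ⟨b, hbt⟩) rfl hside.symm
  rcases (f.map_rel hxy).2 with h | h | h
  · exact hy (h ▸ hx)
  · exact x.2 h
  · exact y.2 h

open Classical in
/-- The number of ordered pairs of adjacent vertices in `S`, i.e. twice the number of edges
spanned by `S`. -/
noncomputable def spannedDarts {V : Type} (G : SimpleGraph V) (S : Finset V) : ℕ :=
  (G.interedges S S).card

theorem spannedDarts_insert {V : Type} [DecidableEq V] (G : SimpleGraph V) [DecidableRel G.Adj]
    {S : Finset V} {v : V} (hv : v ∉ S) :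
    spannedDarts G (insert v S) = spannedDarts G S + 2 * (S.filter (G.Adj v)).card := by
  have h : ∀ T : Finset V,
      spannedDarts G T = ∑ x ∈ T, ∑ y ∈ T, if G.Adj x y then 1 else 0 := by
    intro T
    rw [← Finset.sum_product' T T (fun x y => if G.Adj x y then 1 else 0), ← Finset.card_filter]
    unfold spannedDarts
    congr 1
    ext p
    simp [SimpleGraph.mem_interedges_iff, and_assoc]
  simp only [h, Finset.sum_insert hv, Finset.sum_add_distrib, Finset.card_filter,
    SimpleGraph.irrefl, if_false]
  simp only [G.adj_comm _ v]
  ring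

/-- Every graph has a cut containing at least half of its edges. -/
theorem exists_half_cut {V : Type} [DecidableEq V] (G : SimpleGraph V) (S : Finset V) :
    ∃ P Q : Finset V, Disjoint P Q ∧ P ∪ Q = S ∧
      2 * (spannedDarts G P + spannedDarts G Q) ≤ spannedDarts G S := by
  classical
  induction S using Finset.induction_on with
  | empty => exact ⟨∅, ∅, by simp [spannedDarts, SimpleGraph.interedges, Rel.interedges]⟩
  | insert v S hv ih =>
    obtain ⟨P, Q, hPQ, rfl, hle⟩ := ih
    rw [Finset.mem_union, not_or] at hv
    have hdeg : ((P ∪ Q).filter (G.Adj v)).card =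
        (P.filter (G.Adj v)).card + (Q.filter (G.Adj v)).card := by
      rw [Finset.filter_union, Finset.card_union_of_disjoint
        (Finset.disjoint_filter_filter hPQ)]
    have hins := spannedDarts_insert G (S := P ∪ Q) (v := v) (by simp [hv])
    rcases le_total (P.filter (G.Adj v)).card (Q.filter (G.Adj v)).card with h | h
    · refine ⟨insert v P, Q, ?_, by simp, ?_⟩
      · simp [hv.2, hPQ]
      · rw [hins, spannedDarts_insert G hv.1]
        omega
    · refine ⟨P, insert v Q, ?_, by simp, ?_⟩
      · simp [hv.1, hPQ]
      · rw [hins, spannedDarts_insert G hv.2]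
        omega

theorem le_spannedDarts_glue {V : Type} [Fintype V] (G : SimpleGraph V) (X : Finset V)
    [Fintype (V ⊕ {v // v ∉ X})] :
    2 * spannedDarts G Finset.univ ≤
      spannedDarts (glue G X) Finset.univ + spannedDarts G X := by
  classical
  set A := (G.interedges Finset.univ Finset.univ).image
    (Prod.map (Sum.inl : V → V ⊕ {v // v ∉ X}) (Sum.inl : V → V ⊕ {v // v ∉ X})) with hA
  set B := (G.interedges Finset.univ Finset.univ).image
    (Prod.map (glueRight X) (glueRight X)) with hB
  have hinl := Sum.inl_injective (α := V) (β := {v // v ∉ X})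
  have hr := glueRight_injective X
  have cA : A.card = spannedDarts G Finset.univ := by
    rw [hA, Finset.card_image_of_injective _ (hinl.prodMap hinl)]; rfl
  have cB : B.card = spannedDarts G Finset.univ := by
    rw [hB, Finset.card_image_of_injective _ (hr.prodMap hr)]; rfl
  have hU : A ∪ B ⊆ (glue G X).interedges Finset.univ Finset.univ := by
    intro p hp
    rw [SimpleGraph.mem_interedges_iff]
    refine ⟨Finset.mem_univ _, Finset.mem_univ _, ?_⟩
    rcases Finset.mem_union.1 hp with h | h
    · obtain ⟨q, hq, rfl⟩ := Finset.mem_image.1 h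
      exact (glue_adj_inl G X _ _).2 ((SimpleGraph.mem_interedges_iff _).1 hq).2.2
    · obtain ⟨q, hq, rfl⟩ := Finset.mem_image.1 h
      exact (glue_adj_glueRight G X _ _).2 ((SimpleGraph.mem_interedges_iff _).1 hq).2.2
  have hI : A ∩ B ⊆ (G.interedges X X).image
      (Prod.map (Sum.inl : V → V ⊕ {v // v ∉ X}) (Sum.inl : V → V ⊕ {v // v ∉ X})) := by
    intro p hp
    obtain ⟨h1, h2⟩ := Finset.mem_inter.1 hp
    obtain ⟨q, hq, rfl⟩ := Finset.mem_image.1 h1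
    obtain ⟨r, hr, hqr⟩ := Finset.mem_image.1 h2
    obtain ⟨e1, m1⟩ := glueRight_eq_inl.1 (congrArg Prod.fst hqr)
    obtain ⟨e2, m2⟩ := glueRight_eq_inl.1 (congrArg Prod.snd hqr)
    refine Finset.mem_image_of_mem _ ((SimpleGraph.mem_interedges_iff _).2 ⟨e1 ▸ m1, e2 ▸ m2, ?_⟩)
    exact ((SimpleGraph.mem_interedges_iff _).1 hq).2.2
  have h1 := Finset.card_le_card hU
  have h2 := (Finset.card_le_card hI).trans Finset.card_image_le
  have h3 := Finset.card_union_add_card_inter A B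
  unfold spannedDarts at cA cB ⊢
  omega

theorem spannedDarts_glue_union_le {V : Type} [DecidableEq V] (G : SimpleGraph V)
    {X P Q : Finset V} (hP : Disjoint X P) (hQ : Disjoint X Q) :
    spannedDarts (glue G X) (P.image Sum.inl ∪ Q.image (glueRight X)) ≤
      spannedDarts G P + spannedDarts G Q := by
  classical
  have hsub : (glue G X).interedges (P.image Sum.inl ∪ Q.image (glueRight X))
      (P.image Sum.inl ∪ Q.image (glueRight X)) ⊆
      (G.interedges P P).image (Prod.map Sum.inl Sum.inl) ∪
      (G.interedges Q Q).image (Prod.map (glueRight X) (glueRight X)) := by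
    rintro ⟨p, q⟩ h
    rw [SimpleGraph.mem_interedges_iff] at h
    obtain ⟨hp, hq, hadj⟩ := h
    simp only [Finset.mem_union, Finset.mem_image] at hp hq
    rw [Finset.mem_union, Finset.mem_image, Finset.mem_image]
    rcases hp with ⟨v, hv, rfl⟩ | ⟨v, hv, rfl⟩ <;> rcases hq with ⟨w, hw, rfl⟩ | ⟨w, hw, rfl⟩
    · exact Or.inl ⟨(v, w), (SimpleGraph.mem_interedges_iff _).2
        ⟨hv, hw, (glue_adj_inl G X v w).1 hadj⟩, rfl⟩
    · exact absurd hadj (not_glue_adj_inl_glueRight G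
        (Finset.disjoint_right.1 hP hv) (Finset.disjoint_right.1 hQ hw))
    · exact absurd hadj.symm (not_glue_adj_inl_glueRight G
        (Finset.disjoint_right.1 hP hw) (Finset.disjoint_right.1 hQ hv))
    · exact Or.inr ⟨(v, w), (SimpleGraph.mem_interedges_iff _).2
        ⟨hv, hw, (glue_adj_glueRight G X v w).1 hadj⟩, rfl⟩
  exact (Finset.card_le_card hsub).trans ((Finset.card_union_le _ _).trans
    (add_le_add Finset.card_image_le Finset.card_image_le))

theorem disjoint_image_inl_image_glueRight {V : Type} [DecidableEq V] {X P Q : Finset V}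
    (hQ : Disjoint X Q) :
    Disjoint (P.image (Sum.inl : V → V ⊕ {v // v ∉ X})) (Q.image (glueRight X)) := by
  rw [Finset.disjoint_left]
  intro p hp hq
  obtain ⟨v, -, rfl⟩ := Finset.mem_image.1 hp
  obtain ⟨w, hw, h⟩ := Finset.mem_image.1 hq
  exact Finset.disjoint_right.1 hQ hw (glueRight_eq_inl.1 h).2

theorem card_image_inl_union_image_glueRight {V : Type} [DecidableEq V] {X P Q : Finset V}
    (hQ : Disjoint X Q) :
    (P.image (Sum.inl : V → V ⊕ {v // v ∉ X}) ∪ Q.image (glueRight X)).card =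
      P.card + Q.card := by
  rw [Finset.card_union_of_disjoint (disjoint_image_inl_image_glueRight hQ),
    Finset.card_image_of_injective _ Sum.inl_injective,
    Finset.card_image_of_injective _ (glueRight_injective X)]

theorem spannedDarts_top {V : Type} (S : Finset V) :
    spannedDarts (⊤ : SimpleGraph V) S = S.card * S.card - S.card := by
  classical
  rw [← Finset.offDiag_card]
  unfold spannedDarts
  congr 1
  ext p
  simp [SimpleGraph.mem_interedges_iff]

/-- The graph obtained from a complete graph on `k + M` vertices by `m` successive gluings,
together with the next gluing set `X` and a reservoir `F` of vertices not yet used. -/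
theorem exists_iterated_glue (k M : ℕ) (hkM : k ≤ M) (m : ℕ) :
    ∃ (V : Type) (_ : Fintype V) (G : SimpleGraph V) (X F : Finset V),
      NoLargeConnected k (k + M) G ∧ Disjoint X F ∧ X.card = k ∧ F.card = k ∧
      Fintype.card V = k + 2 ^ m * M ∧
      2 ^ m * spannedDarts G X ≤ k * k - k ∧ 2 ^ m * spannedDarts G F ≤ k * k - k ∧
      (2 : ℝ) ^ m * (((k + M : ℝ) * (k + M) - (k + M)) -
        2 / 3 * (k * k - k) * (1 - 1 / (2 ^ m * 2 ^ m))) ≤ spannedDarts G Finset.univ := by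
  classical
  have hkk : k ≤ k * k := Nat.le_mul_self k
  induction m with
  | zero =>
    have h1 : k ≤ (Finset.univ : Finset (Fin (k + M))).card := by simp
    obtain ⟨X, -, hX⟩ := Finset.exists_subset_card_eq h1
    have h2 : k ≤ (Xᶜ).card := by rw [Finset.card_compl, hX, Fintype.card_fin]; omega
    obtain ⟨F, hF, hFk⟩ := Finset.exists_subset_card_eq h2
    refine ⟨Fin (k + M), inferInstance, ⊤, X, F, ?_, ?_, hX, hFk, by simp, ?_, ?_, ?_⟩
    · intro W H f hf hs
      have := Nat.card_le_card_of_injective f hf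
      rw [Nat.card_fin] at this
      omega
    · exact Finset.disjoint_left.2 fun x hx hxF => Finset.mem_compl.1 (hF hxF) hx
    · rw [spannedDarts_top, hX]; simp
    · rw [spannedDarts_top, hFk]; simp
    · rw [spannedDarts_top, Finset.card_univ, Fintype.card_fin,
        Nat.cast_sub (Nat.le_mul_self _)]
      push_cast
      simp
  | succ m ih =>
    obtain ⟨V, _, G, X, F, hG, hXF, hX, hF, hV, hdX, hdF, hd⟩ := ih
    obtain ⟨P, Q, hPQ, rfl, hcut⟩ := exists_half_cut G F
    rw [Finset.disjoint_union_right] at hXF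
    obtain ⟨hXP, hXQ⟩ := hXF
    rw [Finset.card_union_of_disjoint hPQ] at hF
    have hcut' : 2 ^ (m + 1) * (spannedDarts G P + spannedDarts G Q) ≤ k * k - k := by
      refine le_trans ?_ hdF
      rw [pow_succ, mul_assoc]
      exact Nat.mul_le_mul_left _ hcut
    refine ⟨V ⊕ {v // v ∉ X}, inferInstance, glue G X,
      P.image Sum.inl ∪ Q.image (glueRight X), Q.image Sum.inl ∪ P.image (glueRight X),
      hG.glue hX.le, ?_, ?_, ?_, ?_, ?_, ?_, ?_⟩
    · rw [Finset.disjoint_union_left, Finset.disjoint_union_right, Finset.disjoint_union_right]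
      exact ⟨⟨(Finset.disjoint_image Sum.inl_injective).2 hPQ,
          disjoint_image_inl_image_glueRight hXP⟩,
        (disjoint_image_inl_image_glueRight hXQ).symm,
        (Finset.disjoint_image (glueRight_injective X)).2 hPQ.symm⟩
    · rw [card_image_inl_union_image_glueRight hXQ, hF]
    · rw [card_image_inl_union_image_glueRight hXP, add_comm, hF]
    · rw [← Nat.card_eq_fintype_card, Nat.card_sum, Nat.card_eq_fintype_card,
        Nat.card_eq_fintype_card, Fintype.card_subtype_compl, Fintype.card_coe, hX, hV, pow_succ,
        Nat.add_sub_cancel_left]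
      ring
    · exact (Nat.mul_le_mul_left _ (spannedDarts_glue_union_le G hXP hXQ)).trans hcut'
    · refine (Nat.mul_le_mul_left _ (spannedDarts_glue_union_le G hXQ hXP)).trans ?_
      rwa [add_comm (spannedDarts G Q)]
    · have h1 := le_spannedDarts_glue G X
      have h2 : (2 : ℝ) * spannedDarts G Finset.univ ≤
          spannedDarts (glue G X) Finset.univ +
            spannedDarts G X := by exact_mod_cast h1
      have h3 : (2 : ℝ) ^ m * spannedDarts G X ≤ k * k - k := by
        rw [← Nat.cast_mul, ← Nat.cast_sub hkk]
        exact_mod_cast hdX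
      have hpos : (0 : ℝ) < 2 ^ m := by positivity
      have h4 : (spannedDarts G X : ℝ) ≤ (k * k - k) / 2 ^ m := by
        rw [le_div_iff₀ hpos, mul_comm]
        exact h3
      have h5 : (2 : ℝ) ^ (m + 1) * (((k + M : ℝ) * (k + M) - (k + M)) -
          2 / 3 * (k * k - k) * (1 - 1 / (2 ^ (m + 1) * 2 ^ (m + 1)))) =
          2 * ((2 : ℝ) ^ m * (((k + M : ℝ) * (k + M) - (k + M)) -
          2 / 3 * (k * k - k) * (1 - 1 / (2 ^ m * 2 ^ m)))) - (k * k - k) / 2 ^ m := by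
        rw [pow_succ]
        field_simp
        ring
      rw [h5]
      linarith

theorem spannedDarts_univ {V : Type} [Fintype V] (G : SimpleGraph V) :
    spannedDarts G Finset.univ = 2 * Nat.card G.edgeSet := by
  classical
  rw [Nat.card_eq_fintype_card, ← SimpleGraph.edgeFinset_card, G.two_mul_card_edgeFinset]
  unfold spannedDarts
  congr 1

theorem stmt_3 (k : ℕ) (hk : 0 < k) (σ : ℝ) (hσ : 1 ≤ σ) (hσk : ∃ m : ℕ, σ * k = m)
    (δ : ℝ) (hδ : δ = 2 + σ + 1 / (3 * σ)) :
    ∀ N : ℕ, ∃ (n : ℕ) (G : SimpleGraph (Fin n)),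
      N ≤ n ∧
      δ * k - 2 < 2 * (Nat.card G.edgeSet : ℝ) / n ∧
      ∀ H : G.Subgraph, (1 + σ) * k < (Nat.card H.verts : ℝ) →
        ¬ KConnected (k + 1) H.coe := by
  intro N
  obtain ⟨M, hM⟩ := hσk
  have hk' : (0 : ℝ) < k := by exact_mod_cast hk
  have hkM : k ≤ M := by
    have : (k : ℝ) ≤ M := by rw [← hM]; nlinarith
    exact_mod_cast this
  obtain ⟨m₀, hm₀⟩ := exists_nat_gt (δ * k - 2)
  obtain ⟨V, _, G, X, F, hG, -, -, -, hV, -, -, hd⟩ := exists_iterated_glue k M hkM (N + 2 * m₀)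
  have hpow : N + 2 * m₀ < 2 ^ (N + 2 * m₀) := Nat.lt_two_pow_self
  set p := N + 2 * m₀ with hp
  have hn : 0 < k + 2 ^ p * M := by omega
  let e := G.overFinIso hV
  refine ⟨k + 2 ^ p * M, G.overFin hV, ?_, ?_, ?_⟩
  · have : 2 ^ p ≤ 2 ^ p * M := Nat.le_mul_of_pos_right _ (by omega)
    omega
  · rw [← Nat.card_congr e.mapEdgeSet, lt_div_iff₀ (by exact_mod_cast hn)]
    rw [spannedDarts_univ] at hd
    push_cast at hd ⊢
    have hpos : (0 : ℝ) < 2 ^ p := by positivity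
    have hkk : (0 : ℝ) ≤ k * k - k := by
      rw [sub_nonneg]
      exact_mod_cast Nat.le_mul_self k
    have hpow' : 2 * (m₀ : ℝ) ≤ 2 ^ p := by
      have : 2 * m₀ ≤ 2 ^ p := by omega
      exact_mod_cast this
    refine lt_of_lt_of_le ?_ hd
    have hq : (2 : ℝ) ^ p * (((k + M : ℝ) * (k + M) - (k + M)) - 2 / 3 * (k * k - k)) ≤
        (2 : ℝ) ^ p * (((k + M : ℝ) * (k + M) - (k + M)) -
          2 / 3 * (k * k - k) * (1 - 1 / (2 ^ p * 2 ^ p))) := by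
      refine mul_le_mul_of_nonneg_left ?_ hpos.le
      have : (0 : ℝ) ≤ 2 / 3 * (k * k - k) * (1 / (2 ^ p * 2 ^ p)) := by positivity
      linarith
    refine lt_of_lt_of_le ?_ hq
    have hδσ : δ * σ = 2 * σ + σ ^ 2 + 1 / 3 := by
      rw [hδ]
      field_simp
    have hgap : ((k + M : ℝ) * (k + M) - (k + M)) - 2 / 3 * (k * k - k) - (δ * k - 2) * M =
        k * (σ - 1 / 3) := by
      rw [← hM]
      linear_combination (-(k : ℝ) ^ 2) * hδσ
    have h1 : (δ * k - 2) * k < m₀ * k := mul_lt_mul_of_pos_right hm₀ hk'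
    have h2 : (m₀ : ℝ) * k ≤ 2 ^ p * (k * (σ - 1 / 3)) := by
      have h3 : (k : ℝ) / 2 ≤ k * (σ - 1 / 3) := by nlinarith
      have h4 := mul_le_mul hpow' h3 (by positivity) hpos.le
      linarith
    rw [← hgap] at h2
    linarith
  · intro H hH
    have hcard : k + M < Nat.card H.verts := by
      have : ((k + M : ℕ) : ℝ) < Nat.card H.verts := by
        push_cast
        rw [← hM]
        linarith
      exact_mod_cast this
    exact hG _ _ (e.symm.toHom.comp H.hom) (e.symm.injective.comp H.hom_injective) hcard
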